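/- Let k be a natural number, let γ > 0, let c1 < c2 and s be real numbers, and let ε ∈ {−1, +1}. For each natural number j define Φ_j : ℝ → ℝ by Φ_j(z) = z^{j+1}/(j+1) · (log|z| − 1/(j+1)) for z ≠ 0 and Φ_j(0) = 0. Then the function t ↦ t^k · log(|s − t + εγ|/γ) is integrable on (c1, c2) and ∫_{c1}^{c2} t^k log(|s − t + εγ|/γ) dt = Σ_{j=0}^{k} C(k,j) · (−εγ)^{j+1} · (s + εγ)^{k−j} · (Φ_j(ε(s − c2 + εγ)/γ) − Φ_j(ε(s − c1 + εγ)/γ)), where C(k,j) denotes the binomial coefficient. -/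

import Mathlib

open MeasureTheory intervalIntegral

/-- `Φ_j(z) = z^{j+1}/(j+1) · (log|z| − 1/(j+1))` for `z ≠ 0`, and `Φ_j(0) = 0`. -/
noncomputable def Phi (j : ℕ) (z : ℝ) : ℝ :=
  if z = 0 then 0 else z ^ (j + 1) / (j + 1) * (Real.log |z| - 1 / (j + 1))

lemma Phi_eq (j : ℕ) (z : ℝ) :
    Phi j z = z ^ j / (j + 1) * (z * Real.log z) - z ^ (j + 1) / (j + 1) ^ 2 := by
  have hj : (j : ℝ) + 1 ≠ 0 := by positivity
  unfold Phi
  split_ifs with hz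
  · simp [hz]
  · rw [Real.log_abs]
    field_simp
    ring

lemma Phi_continuous (j : ℕ) : Continuous (Phi j) := by
  have : Phi j = fun z => z ^ j / (j + 1) * (z * Real.log z) - z ^ (j + 1) / (j + 1) ^ 2 :=
    funext (Phi_eq j)
  rw [this]
  have h1 := Real.continuous_mul_log
  fun_prop

lemma Phi_hasDerivAt (j : ℕ) (z : ℝ) (hz : z ≠ 0) :
    HasDerivAt (Phi j) (z ^ j * Real.log z) z := by
  have hj : (j : ℝ) + 1 ≠ 0 := by positivity
  have h1 : HasDerivAt (fun z : ℝ => z ^ (j + 1) / (j + 1) * (Real.log z - 1 / (j + 1)))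
      (((j + 1 : ℕ) * z ^ j) / (j + 1) * (Real.log z - 1 / (j + 1))
        + z ^ (j + 1) / (j + 1) * z⁻¹) z := by
    have := ((hasDerivAt_pow (j + 1) z).div_const ((j : ℝ) + 1)).fun_mul
      ((Real.hasDerivAt_log hz).sub_const (1 / ((j : ℝ) + 1)))
    simpa using this
  have h2 : Phi j = fun z : ℝ => z ^ (j + 1) / (j + 1) * (Real.log z - 1 / (j + 1)) := by
    funext z
    unfold Phi
    split_ifs with h
    · simp [h]
    · rw [Real.log_abs]
  rw [h2]
  convert h1 using 1
  push_cast
  field_simp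
  ring

/-- Closed form for `∫_{c1}^{c2} t^k log(|s − t + εγ|/γ) dt` (closed-curve modified moments). -/
theorem stmt1 (k : ℕ) (γ c1 c2 s ε : ℝ) (hγ : 0 < γ) (h : c1 < c2)
    (hε : ε = 1 ∨ ε = -1) :
    IntervalIntegrable (fun t => t ^ k * Real.log (|s - t + ε * γ| / γ)) volume c1 c2 ∧
    ∫ t in c1..c2, t ^ k * Real.log (|s - t + ε * γ| / γ) =
      ∑ j ∈ Finset.range (k + 1),
        (k.choose j : ℝ) * (-(ε * γ)) ^ (j + 1) * (s + ε * γ) ^ (k - j) *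
          (Phi j (ε * (s - c2 + ε * γ) / γ) - Phi j (ε * (s - c1 + ε * γ) / γ)) := by
  have hε2 : ε * ε = 1 := by rcases hε with rfl | rfl <;> norm_num
  have hε0 : ε ≠ 0 := by rcases hε with rfl | rfl <;> norm_num
  have hγ0 : γ ≠ 0 := hγ.ne'
  have hlog : ∀ t : ℝ, Real.log (|s - t + ε * γ| / γ)
      = Real.log (ε * (s - t + ε * γ) / γ) := by
    intro t
    rw [← Real.log_abs (ε * (s - t + ε * γ) / γ), abs_div, abs_mul, abs_of_pos hγ]
    rcases hε with rfl | rfl <;> simp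
  have hint : IntervalIntegrable
      (fun t => t ^ k * Real.log (|s - t + ε * γ| / γ)) volume c1 c2 := by
    have hm : IntervalIntegrable
        (fun t => Real.log (|s - t + ε * γ| / γ)) volume c1 c2 := by
      simp_rw [hlog]
      exact MeromorphicOn.intervalIntegrable_log
        (f := fun t => ε * (s - t + ε * γ) / γ) (fun x _ => by fun_prop)
    exact hm.continuousOn_mul (by fun_prop)
  refine ⟨hint, ?_⟩
  have key := MeasureTheory.integral_eq_of_hasDerivAt_off_countable_of_le
    (fun t => ∑ j ∈ Finset.range (k + 1),
        (k.choose j : ℝ) * (-(ε * γ)) ^ (j + 1) * (s + ε * γ) ^ (k - j) *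
          Phi j (ε * (s - t + ε * γ) / γ))
    (fun t => t ^ k * Real.log (|s - t + ε * γ| / γ)) h.le
    (Set.countable_singleton (s + ε * γ)) ?_ ?_ hint
  · rw [key, ← Finset.sum_sub_distrib]
    exact Finset.sum_congr rfl fun j _ => by ring
  · apply Continuous.continuousOn
    refine continuous_finsetSum _ fun j _ => ?_
    have := Phi_continuous j
    fun_prop
  · rintro t ⟨-, ht⟩
    have hne : s - t + ε * γ ≠ 0 := by
      intro h0
      apply ht
      simp only [Set.mem_singleton_iff]
      linarith
    have hz : ε * (s - t + ε * γ) / γ ≠ 0 := div_ne_zero (mul_ne_zero hε0 hne) hγ0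
    have hzd : HasDerivAt (fun t => ε * (s - t + ε * γ) / γ) (ε * (-1) / γ) t :=
      (((((hasDerivAt_id t).const_sub s).add_const (ε * γ)).const_mul ε).div_const γ)
    have hsum := HasDerivAt.fun_sum (u := Finset.range (k + 1)) fun j _ =>
      ((Phi_hasDerivAt j _ hz).comp t hzd).const_mul
        ((k.choose j : ℝ) * (-(ε * γ)) ^ (j + 1) * (s + ε * γ) ^ (k - j))
    refine HasDerivAt.congr_deriv hsum ?_
    symm
    show t ^ k * Real.log (|s - t + ε * γ| / γ) = _
    rw [hlog]
    have ht' : t = (-(ε * γ)) * (ε * (s - t + ε * γ) / γ) + (s + ε * γ) := by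
      field_simp
      linear_combination (s - t + ε * γ) * hε2
    have hc : (-(ε * γ)) * (ε * (-1) / γ) = 1 := by
      field_simp
      linear_combination hε2
    generalize ε * (s - t + ε * γ) / γ = z at *
    generalize ε * (-1) / γ = d at *
    rw [ht', add_pow, Finset.sum_mul]
    refine Finset.sum_congr rfl fun j _ => ?_
    rw [mul_pow, pow_succ]
    linear_combination (-(k.choose j : ℝ) * (-(ε * γ)) ^ j * (s + ε * γ) ^ (k - j)
      * z ^ j * Real.log z) * hc
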